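/- Let K = ℂ with σ acting as the identity on ℂ, and consider the σ-polynomial ring ℂ{y_1, y_2, y_3, y_4}. Let I = ⟨y_1^2(y_3 − y_4), y_2^2(y_3 − y_4)⟩ be the well-mixed closure of {y_1^2(y_3 − y_4), y_2^2(y_3 − y_4)}. Then (y_1^x y_2 − y_1 y_2^x)(y_3 − y_4) ∈ I, but y_1^x y_2 (y_3 − y_4) ∉ I and y_1 y_2^x (y_3 − y_4) ∉ I; consequently I is not a binomial σ-ideal, i.e., I is not generated as a σ-ideal by any set of binomials aY^f + bY^g with a, b ∈ ℂ^×. -/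

import Mathlib

open Polynomial

section SigmaRing

variable {R : Type*} [CommRing R]

/-- A σ-ideal: an ideal closed under the difference operator σ. -/
def IsSigmaIdeal (σ : R →+* R) (I : Ideal R) : Prop := ∀ a ∈ I, σ a ∈ I

/-- A σ-ideal is well-mixed if `a * b ∈ I` implies `a * σ b ∈ I`. -/
def IsWellMixed (σ : R →+* R) (I : Ideal R) : Prop := ∀ a b : R, a * b ∈ I → a * σ b ∈ I

/-- `[F]`, the smallest σ-ideal containing `F`. -/
def sigmaIdealGen (σ : R →+* R) (F : Set R) : Ideal R :=
  sInf {I : Ideal R | F ⊆ I ∧ IsSigmaIdeal σ I}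

/-- `⟨F⟩`, the smallest well-mixed σ-ideal containing `F` (well-mixed closure). -/
def wmClosure (σ : R →+* R) (F : Set R) : Ideal R :=
  sInf {I : Ideal R | F ⊆ I ∧ IsSigmaIdeal σ I ∧ IsWellMixed σ I}

/-- `⟨F⟩_r`, the smallest radical well-mixed σ-ideal containing `F`. -/
def rwmClosure (σ : R →+* R) (F : Set R) : Ideal R :=
  sInf {I : Ideal R | F ⊆ I ∧ IsSigmaIdeal σ I ∧ IsWellMixed σ I ∧ I.IsRadical}

/-- Symbolic exponent: for `p = Σ c_i x^i ∈ ℕ[x]`, `a^p = Π (σ^i a)^(c_i)`. -/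
noncomputable def sexp (σ : R →+* R) (a : R) (p : Polynomial ℕ) : R :=
  ∏ i ∈ Finset.range (p.natDegree + 1), ((⇑σ)^[i] a) ^ (p.coeff i)

/-- `I` is finitely generated as a radical well-mixed σ-ideal. -/
def FinGenAsRWM (σ : R →+* R) (I : Ideal R) : Prop :=
  ∃ G : Set R, G.Finite ∧ G ⊆ (I : Set R) ∧ I = rwmClosure σ G

/-- σ-prime: a reflexive σ-ideal which is prime. -/
def IsSigmaPrime (σ : R →+* R) (I : Ideal R) : Prop :=
  IsSigmaIdeal σ I ∧ (∀ a : R, σ a ∈ I → a ∈ I) ∧ I.IsPrime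

end SigmaRing

/-- The σ-polynomial ring `K{y_1,…,y_n}`: polynomials in variables `y_i^{x^j}`,
indexed by pairs `(i, j) ∈ Fin n × ℕ`. -/
abbrev DPoly (K : Type*) [Field K] (n : ℕ) := MvPolynomial (Fin n × ℕ) K

section DPoly

variable {K : Type*} [Field K] {n : ℕ} (σK : K →+* K)

/-- The difference operator on `K{y_1,…,y_n}` extending `σK`, with `σ(y_i^{x^j}) = y_i^{x^{j+1}}`. -/
noncomputable def shift : DPoly K n →+* DPoly K n :=
  MvPolynomial.eval₂Hom ((MvPolynomial.C : K →+* DPoly K n).comp σK)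
    (fun v => MvPolynomial.X (v.1, v.2 + 1))

/-- `y_i^p` for `p ∈ ℕ[x]`. -/
noncomputable def ypow (i : Fin n) (p : Polynomial ℕ) : DPoly K n :=
  sexp (shift σK) (MvPolynomial.X (i, 0)) p

/-- `y_i^{x^a}`. -/
noncomputable def varPow (i : Fin n) (a : ℕ) : DPoly K n :=
  ypow σK i (Polynomial.X ^ a)

/-- The monomial `Y^f = Π y_i^{f_i}` for `f ∈ ℕ[x]^n`. -/
noncomputable def monom (f : Fin n → Polynomial ℕ) : DPoly K n :=
  ∏ i, ypow σK i (f i)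

/-- A pure binomial `Y^f − Y^g`. -/
def IsPureBinomial (p : DPoly K n) : Prop :=
  ∃ f g : Fin n → Polynomial ℕ, p = monom σK f - monom σK g

/-- A binomial `a·Y^f + b·Y^g` with `a, b ∈ K^×`. -/
def IsBinomial (p : DPoly K n) : Prop :=
  ∃ (a b : K) (f g : Fin n → Polynomial ℕ), a ≠ 0 ∧ b ≠ 0 ∧
    p = MvPolynomial.C a * monom σK f + MvPolynomial.C b * monom σK g

/-- A pure binomial σ-ideal: a σ-ideal generated by pure binomials. -/
def IsPureBinomialSigmaIdeal (I : Ideal (DPoly K n)) : Prop :=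
  ∃ S : Set (DPoly K n), (∀ p ∈ S, IsPureBinomial σK p) ∧ I = sigmaIdealGen (shift σK) S

/-- Positive part of `f ∈ ℤ[x]`. -/
noncomputable def posPart (f : Polynomial ℤ) : Polynomial ℕ :=
  f.sum fun i c => Polynomial.monomial i c.toNat

/-- Negative part of `f ∈ ℤ[x]`. -/
noncomputable def negPart (f : Polynomial ℤ) : Polynomial ℕ :=
  f.sum fun i c => Polynomial.monomial i (-c).toNat

/-- The lattice σ-ideal `I_L = [Y^{f_+} − Y^{f_−} : f ∈ L]` of a ℤ[x]-lattice `L ⊆ ℤ[x]^n`. -/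
noncomputable def latticeIdeal (L : Submodule (Polynomial ℤ) (Fin n → Polynomial ℤ)) :
    Ideal (DPoly K n) :=
  sigmaIdealGen (shift σK)
    {p | ∃ f ∈ L, p = monom σK (fun i => posPart (f i)) - monom σK (fun i => negPart (f i))}

end DPoly

/-- `𝔪`: the multiplicatively closed set generated by the variables `y_i^{x^j}`. -/
def mSet (K : Type*) [Field K] (n : ℕ) : Set (DPoly K n) :=
  (Submonoid.closure (Set.range fun v : Fin n × ℕ => (MvPolynomial.X v : DPoly K n)) : Set _)

/-- `I : 𝔪 = {p : M p ∈ I for some M ∈ 𝔪}`. -/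
def colonM {K : Type*} [Field K] {n : ℕ} (I : Ideal (DPoly K n)) : Set (DPoly K n) :=
  {p | ∃ M ∈ mSet K n, M * p ∈ I}

section Tsec

variable {K : Type*} [Field K] {n t : ℕ} (σK : K →+* K)

/-- The set `T^{a_1…a_t}_{j_1…j_t}` of monomials `Y^f` with `deg f_{j_i} < a_i`. -/
def Tset (j : Fin t → Fin n) (a : Fin t → ℕ) : Set (DPoly K n) :=
  {p | ∃ f : Fin n → Polynomial ℕ,
    (∀ i : Fin t, (f (j i)).degree < (a i : WithBot ℕ)) ∧ p = monom σK f}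

/-- `I` is saturated with respect to `{y_{j_1}^{x^{a_1}},…,y_{j_t}^{x^{a_t}}}`. -/
def SaturatedWrt (j : Fin t → Fin n) (a : Fin t → ℕ) (I : Ideal (DPoly K n)) : Prop :=
  ∀ g M : DPoly K n, M ∈ Tset σK j a → M * g ∈ I → g ∈ I

/-- `J : T = {g : M g ∈ J for some M ∈ T}`. -/
def colonT (j : Fin t → Fin n) (a : Fin t → ℕ) (J : Ideal (DPoly K n)) : Set (DPoly K n) :=
  {g | ∃ M ∈ Tset σK j a, M * g ∈ J}

/-- The `T`-saturated closure `N^{a_1…a_t}_{j_1…j_t}(I)`: the smallest saturated σ-ideal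
containing `I`. -/
noncomputable def Nclosure (j : Fin t → Fin n) (a : Fin t → ℕ) (I : Ideal (DPoly K n)) :
    Ideal (DPoly K n) :=
  sInf {J : Ideal (DPoly K n) | I ≤ J ∧ IsSigmaIdeal (shift σK) J ∧ SaturatedWrt σK j a J}

/-- The set of variables `{y_{j_1}^{x^{a_1}},…,y_{j_t}^{x^{a_t}}}`. -/
noncomputable def varSet (j : Fin t → Fin n) (a : Fin t → ℕ) : Set (DPoly K n) :=
  Set.range fun i => varPow σK (j i) (a i)

/-- `⟨I₀ ∪ {y_{j_1}^{x^{a_1}},…,y_{j_t}^{x^{a_t}}}⟩_r` is quasi-normal. -/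
def QuasiNormal (j : Fin t → Fin n) (a : Fin t → ℕ) (I0 : Ideal (DPoly K n)) : Prop :=
  SaturatedWrt σK j a I0 ∧
  ∀ f g : Fin n → Polynomial ℕ, monom σK f - monom σK g ∈ I0 →
    monom σK f ∈ sigmaIdealGen (shift σK) (varSet σK j a) →
    monom σK g ∈ sigmaIdealGen (shift σK) (varSet σK j a)

end Tsec

/-- The kernel of a morphism of difference rings is a σ-ideal, well-mixed if `0` is well-mixed in the
target; so it contains the well-mixed closure of every subset of it. -/
theorem wmClosure_le_ker {R B : Type*} [CommRing R] [CommRing B] {σ : R →+* R} {τ : B →+* B}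
    {φ : R →+* B} (h : φ.comp σ = τ.comp φ) (hB : ∀ a b : B, a * b = 0 → a * τ b = 0)
    {F : Set R} (hF : ∀ p ∈ F, φ p = 0) : wmClosure σ F ≤ RingHom.ker φ := by
  have h' : ∀ a, φ (σ a) = τ (φ a) := fun a => RingHom.congr_fun h a
  refine sInf_le ⟨fun p hp => hF p hp, fun a ha => ?_, fun a b hab => ?_⟩
  · rw [RingHom.mem_ker] at *
    rw [h', ha, map_zero]
  · rw [RingHom.mem_ker, map_mul] at *
    rw [h']
    exact hB _ _ hab

theorem mem_wmClosure {R : Type*} [CommRing R] {σ : R →+* R} {F : Set R} {p : R} :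
    p ∈ wmClosure σ F ↔
      ∀ I : Ideal R, F ⊆ I → IsSigmaIdeal σ I → IsWellMixed σ I → p ∈ I := by
  simp [wmClosure, Submodule.mem_sInf]

theorem subset_wmClosure {R : Type*} [CommRing R] (σ : R →+* R) (F : Set R) :
    F ⊆ wmClosure σ F :=
  fun _ hp => mem_wmClosure.2 fun _ hF _ _ => hF hp

theorem wmClosure_isSigmaIdeal {R : Type*} [CommRing R] (σ : R →+* R) (F : Set R) :
    IsSigmaIdeal σ (wmClosure σ F) :=
  fun _ ha => mem_wmClosure.2 fun _ hF hI hw => hI _ (mem_wmClosure.1 ha _ hF hI hw)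

theorem wmClosure_isWellMixed {R : Type*} [CommRing R] (σ : R →+* R) (F : Set R) :
    IsWellMixed σ (wmClosure σ F) :=
  fun _ _ hab => mem_wmClosure.2 fun _ hF hI hw => hw _ _ (mem_wmClosure.1 hab _ hF hI hw)

/-- From `a²w, b²w ∈ I` one gets `(σ(a)b - aσ(b))w ∈ I` by splitting `a² - b²`. -/
theorem IsWellMixed.cross_mem {R : Type*} [CommRing R] {σ : R →+* R} {I : Ideal R}
    (hI : IsWellMixed σ I) {a b w : R} (ha : a ^ 2 * w ∈ I) (hb : b ^ 2 * w ∈ I) :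
    (σ a * b - a * σ b) * w ∈ I := by
  have h1 : (a * w) * σ a ∈ I := hI _ _ (by convert ha using 1; ring)
  have h2 : (b * w) * σ b ∈ I := hI _ _ (by convert hb using 1; ring)
  have h3 : ((a - b) * w) * σ (a + b) ∈ I :=
    hI _ _ (by convert I.sub_mem ha hb using 1; ring)
  convert I.sub_mem (I.sub_mem h1 h2) h3 using 1
  rw [map_add]
  ring

/-- The algebra `ℂ[a, b, σa, σb] / (a², b², aσa, bσb, σ(a)b - aσ(b), (σa, σb)²)`, in coordinates with
respect to the basis `1, a, b, ab, σa, σb, aσ(b)`. -/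
@[ext]
structure CrossRing where
  /-- The coefficient at `1`. -/
  c : ℂ
  /-- The coefficient at `a`. -/
  a : ℂ
  /-- The coefficient at `b`. -/
  b : ℂ
  /-- The coefficient at `ab`. -/
  ab : ℂ
  /-- The coefficient at `σa`. -/
  sa : ℂ
  /-- The coefficient at `σb`. -/
  sb : ℂ
  /-- The coefficient at `aσ(b) = σ(a)b`. -/
  asb : ℂ

namespace CrossRing

instance : Zero CrossRing := ⟨⟨0, 0, 0, 0, 0, 0, 0⟩⟩

instance : One CrossRing := ⟨⟨1, 0, 0, 0, 0, 0, 0⟩⟩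

noncomputable instance : Add CrossRing :=
  ⟨fun x y => ⟨x.c + y.c, x.a + y.a, x.b + y.b, x.ab + y.ab, x.sa + y.sa, x.sb + y.sb,
    x.asb + y.asb⟩⟩

noncomputable instance : Neg CrossRing :=
  ⟨fun x => ⟨-x.c, -x.a, -x.b, -x.ab, -x.sa, -x.sb, -x.asb⟩⟩

noncomputable instance : Mul CrossRing :=
  ⟨fun x y => ⟨x.c * y.c, x.c * y.a + x.a * y.c, x.c * y.b + x.b * y.c,
    x.c * y.ab + x.ab * y.c + x.a * y.b + x.b * y.a, x.c * y.sa + x.sa * y.c,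
    x.c * y.sb + x.sb * y.c,
    x.c * y.asb + x.asb * y.c + x.a * y.sb + x.sb * y.a + x.b * y.sa + x.sa * y.b⟩⟩

theorem zero_def : (0 : CrossRing) = ⟨0, 0, 0, 0, 0, 0, 0⟩ := rfl

theorem one_def : (1 : CrossRing) = ⟨1, 0, 0, 0, 0, 0, 0⟩ := rfl

theorem add_def (x y : CrossRing) : x + y =
    ⟨x.c + y.c, x.a + y.a, x.b + y.b, x.ab + y.ab, x.sa + y.sa, x.sb + y.sb, x.asb + y.asb⟩ := rfl

theorem neg_def (x : CrossRing) :
    -x = ⟨-x.c, -x.a, -x.b, -x.ab, -x.sa, -x.sb, -x.asb⟩ := rfl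

theorem mul_def (x y : CrossRing) : x * y =
    ⟨x.c * y.c, x.c * y.a + x.a * y.c, x.c * y.b + x.b * y.c,
      x.c * y.ab + x.ab * y.c + x.a * y.b + x.b * y.a, x.c * y.sa + x.sa * y.c,
      x.c * y.sb + x.sb * y.c,
      x.c * y.asb + x.asb * y.c + x.a * y.sb + x.sb * y.a + x.b * y.sa + x.sa * y.b⟩ := rfl

noncomputable instance : CommRing CrossRing where
  add_assoc x y z := by ext <;> simp only [add_def] <;> ring
  zero_add x := by ext <;> simp [add_def, zero_def]
  add_zero x := by ext <;> simp [add_def, zero_def]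
  add_comm x y := by ext <;> simp only [add_def] <;> ring
  neg_add_cancel x := by ext <;> simp [add_def, zero_def, neg_def]
  mul_assoc x y z := by ext <;> simp only [mul_def] <;> ring
  mul_comm x y := by ext <;> simp only [mul_def] <;> ring
  one_mul x := by ext <;> simp [mul_def, one_def]
  mul_one x := by ext <;> simp [mul_def, one_def]
  left_distrib x y z := by ext <;> simp only [mul_def, add_def] <;> ring
  right_distrib x y z := by ext <;> simp only [mul_def, add_def] <;> ring
  zero_mul x := by ext <;> simp [mul_def, zero_def]
  mul_zero x := by ext <;> simp [mul_def, zero_def]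
  nsmul := nsmulRec
  zsmul := zsmulRec

/-- The inclusion of the constants. -/
noncomputable def const : ℂ →+* CrossRing where
  toFun r := ⟨r, 0, 0, 0, 0, 0, 0⟩
  map_one' := rfl
  map_zero' := rfl
  map_add' r s := by simp [add_def]
  map_mul' r s := by simp [mul_def]

/-- The endomorphism `a ↦ σa`, `b ↦ σb`, `σa ↦ 0`, `σb ↦ 0`. -/
noncomputable def sigma : CrossRing →+* CrossRing where
  toFun x := ⟨x.c, 0, 0, 0, x.a, x.b, 0⟩
  map_one' := rfl
  map_zero' := rfl
  map_add' x y := by simp [add_def]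
  map_mul' x y := by simp [mul_def]

theorem sigma_apply (x : CrossRing) : sigma x = ⟨x.c, 0, 0, 0, x.a, x.b, 0⟩ := rfl

theorem eq_zero_of_mul_eq_zero {x y : CrossRing} (h : x * y = 0) (hx : x.c ≠ 0) : y = 0 := by
  simp only [mul_def, zero_def, CrossRing.mk.injEq] at h
  obtain ⟨h1, h2, h3, h4, h5, h6, h7⟩ := h
  have hc : y.c = 0 := by simpa [hx] using h1
  have ha : y.a = 0 := by simpa [hx, hc] using h2
  have hb : y.b = 0 := by simpa [hx, hc] using h3
  have hsa : y.sa = 0 := by simpa [hx, hc] using h5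
  have hsb : y.sb = 0 := by simpa [hx, hc] using h6
  ext <;> simp_all [zero_def]

theorem mul_sigma_eq_zero {x y : CrossRing} (h : x * y = 0) : x * sigma y = 0 := by
  by_cases hx : x.c = 0
  · by_cases hy : y.c = 0
    · have hab := congrArg CrossRing.ab h
      simp only [mul_def, zero_def, hx, hy] at hab
      ext <;> simp [sigma_apply, mul_def, zero_def, hx, hy]
      linear_combination hab
    · rw [eq_zero_of_mul_eq_zero ((mul_comm y x).trans h) hy, zero_mul]
  · rw [eq_zero_of_mul_eq_zero h hx, map_zero, mul_zero]

/-- Images of the variables: `y₁ ↦ a`, `σ y₁ ↦ σa`, `y₂ ↦ b`, `σ y₂ ↦ σb`, `σʲ y₃ ↦ 1`,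
everything else to `0`. -/
def var : Fin 4 × ℕ → CrossRing
  | (0, 0) => ⟨0, 1, 0, 0, 0, 0, 0⟩
  | (0, 1) => ⟨0, 0, 0, 0, 1, 0, 0⟩
  | (1, 0) => ⟨0, 0, 1, 0, 0, 0, 0⟩
  | (1, 1) => ⟨0, 0, 0, 0, 0, 1, 0⟩
  | (2, _) => 1
  | _ => 0

theorem var_succ (i : Fin 4) (j : ℕ) : var (i, j + 1) = sigma (var (i, j)) := by
  fin_cases i <;> rcases j with _ | _ | j <;> rfl

/-- The evaluation morphism from `ℂ{y₁, y₂, y₃, y₄}`. -/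
noncomputable def evalHom : DPoly ℂ 4 →+* CrossRing :=
  MvPolynomial.eval₂Hom const var

theorem evalHom_comp_shift : evalHom.comp (shift (RingHom.id ℂ)) = sigma.comp evalHom := by
  apply MvPolynomial.ringHom_ext
  · intro r
    simp [evalHom, shift, sigma_apply, const]
  · rintro ⟨i, j⟩
    simp [evalHom, shift, var_succ]

end CrossRing

theorem shift_id_eq_rename {n : ℕ} :
    shift (n := n) (RingHom.id ℂ) =
      (MvPolynomial.rename (R := ℂ) fun v : Fin n × ℕ => (v.1, v.2 + 1) :
        DPoly ℂ n →ₐ[ℂ] DPoly ℂ n).toRingHom := by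
  apply MvPolynomial.ringHom_ext <;> intros <;> simp [shift]

theorem shift_iterate_X {n : ℕ} (i : Fin n) (k : ℕ) :
    (shift (RingHom.id ℂ))^[k] (MvPolynomial.X (i, 0)) = MvPolynomial.X (i, k) := by
  induction k with
  | zero => rfl
  | succ k ih => rw [Function.iterate_succ_apply', ih]; simp [shift]

theorem exists_monom_eq_monomial {n : ℕ} (f : Fin n → Polynomial ℕ) :
    ∃ e, monom (RingHom.id ℂ) f = MvPolynomial.monomial e 1 := by
  suffices h : monom (RingHom.id ℂ) f ∈
      MonoidHom.mrange (MvPolynomial.monomialOneHom ℂ (Fin n × ℕ)) by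
    obtain ⟨e, he⟩ := h
    exact ⟨e.toAdd, he.symm⟩
  refine Submonoid.prod_mem _ fun i _ => ?_
  rw [ypow, sexp]
  refine Submonoid.prod_mem _ fun k _ => Submonoid.pow_mem _ ?_ _
  rw [shift_iterate_X]
  exact ⟨Multiplicative.ofAdd (Finsupp.single (i, k) 1), rfl⟩

/-- If `I` is generated as a σ-ideal by binomials, a linear coefficient functional vanishing on the
two-term polynomials of `I` vanishes on `I`. -/
theorem coeff_eq_zero_of_binomial {n : ℕ} {S : Set (DPoly ℂ n)} {I : Ideal (DPoly ℂ n)}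
    (hS : ∀ p ∈ S, IsBinomial (RingHom.id ℂ) p) (hI : IsSigmaIdeal (shift (RingHom.id ℂ)) I)
    (hSI : I = sigmaIdealGen (shift (RingHom.id ℂ)) S) {m : Fin n × ℕ →₀ ℕ}
    (hm : ∀ f g a b, MvPolynomial.monomial f a + MvPolynomial.monomial g b ∈ I →
      MvPolynomial.coeff m (MvPolynomial.monomial f a + MvPolynomial.monomial g b) = 0)
    {p : DPoly ℂ n} (hp : p ∈ I) : MvPolynomial.coeff m p = 0 := by
  let T : Set (DPoly ℂ n) :=
    {q | q ∈ I ∧ ∃ f g a b, q = MvPolynomial.monomial f a + MvPolynomial.monomial g b}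
  have hST : S ⊆ I := by
    rw [hSI]
    exact fun s hs => Submodule.mem_sInf.2 fun _ hJ => hJ.1 hs
  have hle : I ≤ Ideal.span T := by
    conv_lhs => rw [hSI]
    refine sInf_le ⟨fun s hs => Ideal.subset_span ⟨hST hs, ?_⟩, fun q hq => ?_⟩
    · obtain ⟨a, b, f, g, -, -, rfl⟩ := hS s hs
      obtain ⟨e, he⟩ := exists_monom_eq_monomial f
      obtain ⟨e', he'⟩ := exists_monom_eq_monomial g
      exact ⟨e, e', a, b, by simp [he, he', MvPolynomial.C_mul_monomial]⟩
    · suffices h : Ideal.span T ≤ (Ideal.span T).comap (shift (RingHom.id ℂ)) from h hq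
      refine Ideal.span_le.2 ?_
      rintro q ⟨hqI, f, g, a, b, rfl⟩
      refine Ideal.subset_span ⟨hI _ hqI, f.mapDomain fun v => (v.1, v.2 + 1),
        g.mapDomain fun v => (v.1, v.2 + 1), a, b, ?_⟩
      rw [shift_id_eq_rename]
      simp only [AlgHom.toRingHom_eq_coe, RingHom.coe_coe, map_add, MvPolynomial.rename_monomial]
  have key : ∀ q ∈ T, ∀ r : DPoly ℂ n, MvPolynomial.coeff m (r * q) = 0 := by
    rintro q ⟨hqI, f, g, a, b, rfl⟩ r
    induction r using MvPolynomial.induction_on' with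
    | monomial e c =>
      have := I.mul_mem_left (MvPolynomial.monomial e c) hqI
      simp only [mul_add, MvPolynomial.monomial_mul] at this ⊢
      exact hm _ _ _ _ this
    | add r s hr hs => rw [add_mul, MvPolynomial.coeff_add, hr, hs, add_zero]
  rw [← one_mul p]
  refine Submodule.span_induction (p := fun q _ => ∀ r, MvPolynomial.coeff m (r * q) = 0)
    key ?_ ?_ ?_ (hle hp) 1
  · simp
  · intro x y _ _ hx hy r
    rw [mul_add, MvPolynomial.coeff_add, hx, hy, add_zero]
  · intro s x _ hx r
    rw [smul_eq_mul, ← mul_assoc]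
    exact hx _

/-- The identification of indices that sends `y₄` to `y₃`. -/
def foldVar (v : Fin 4 × ℕ) : Fin 4 × ℕ := if v.1 = 3 then (2, v.2) else v

theorem rename_foldVar_comp_shift :
    (MvPolynomial.rename (R := ℂ) foldVar).toRingHom.comp (shift (RingHom.id ℂ)) =
      (shift (RingHom.id ℂ)).comp (MvPolynomial.rename (R := ℂ) foldVar).toRingHom := by
  apply MvPolynomial.ringHom_ext
  · intro r
    simp [shift]
  · rintro ⟨i, j⟩
    by_cases h : i = 3 <;> simp [shift, foldVar, h]

theorem mapDomain_foldVar_two (g : Fin 4 × ℕ →₀ ℕ) (j : ℕ) :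
    Finsupp.mapDomain foldVar g (2, j) = g (2, j) + g (3, j) := by
  induction g using Finsupp.induction_linear with
  | zero => simp
  | add f g hf hg => simp [Finsupp.mapDomain_add, hf, hg]; omega
  | single v c =>
    obtain ⟨i, k⟩ := v
    fin_cases i <;> simp [Finsupp.mapDomain_single, foldVar, Finsupp.single_apply]

theorem mapDomain_foldVar_of_lt (g : Fin 4 × ℕ →₀ ℕ) {i : Fin 4} (hi : i < 2) (j : ℕ) :
    Finsupp.mapDomain foldVar g (i, j) = g (i, j) := by
  induction g using Finsupp.induction_linear with
  | zero => simp
  | add f g hf hg => simp [Finsupp.mapDomain_add, hf, hg]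
  | single v c =>
    obtain ⟨l, k⟩ := v
    fin_cases i <;> fin_cases l <;>
      simp_all [Finsupp.mapDomain_single, foldVar, Finsupp.single_apply]

/-- The exponent of `σ(y₁)y₂yᵢ`. -/
noncomputable def crossExp (i : Fin 4) : Fin 4 × ℕ →₀ ℕ :=
  Finsupp.single (0, 1) 1 + Finsupp.single (1, 0) 1 + Finsupp.single (i, 0) 1

theorem monomial_crossExp (i : Fin 4) (c : ℂ) :
    MvPolynomial.monomial (crossExp i) c =
      MvPolynomial.C c * (MvPolynomial.X (0, 1) * MvPolynomial.X (1, 0) * MvPolynomial.X (i, 0)) := by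
  simp [crossExp, MvPolynomial.X, MvPolynomial.monomial_mul, MvPolynomial.C_mul_monomial]

theorem mapDomain_foldVar_crossExp : Finsupp.mapDomain foldVar (crossExp 2) = crossExp 2 := by
  simp [crossExp, Finsupp.mapDomain_add, Finsupp.mapDomain_single, foldVar]

theorem eq_crossExp_of_mapDomain {g : Fin 4 × ℕ →₀ ℕ}
    (h : Finsupp.mapDomain foldVar g = crossExp 2) : g = crossExp 2 ∨ g = crossExp 3 := by
  have hlt : ∀ i : Fin 4, i < 2 → ∀ j, g (i, j) = crossExp 2 (i, j) := fun i hi j => by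
    rw [← mapDomain_foldVar_of_lt g hi, h]
  have htwo : ∀ j, g (2, j) + g (3, j) = crossExp 2 (2, j) := fun j => by
    rw [← mapDomain_foldVar_two, h]
  have hpos : ∀ j, 0 < j → g (2, j) = 0 ∧ g (3, j) = 0 := fun j hj => by
    have := htwo j
    simp [crossExp, hj.ne] at this
    exact this
  have hzero : g (2, 0) + g (3, 0) = 1 := by
    rw [htwo 0]
    simp [crossExp]
  have hcases : g (2, 0) = 1 ∧ g (3, 0) = 0 ∨ g (2, 0) = 0 ∧ g (3, 0) = 1 := by omega
  refine hcases.imp (fun hc => ?_) fun hc => ?_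
  all_goals
    ext ⟨i, j⟩
    fin_cases i
    · simp [hlt 0 (by decide) j, crossExp, Finsupp.single_apply]
    · simp [hlt 1 (by decide) j, crossExp, Finsupp.single_apply]
    all_goals
      rcases j.eq_zero_or_pos with rfl | hj
      · simp [hc, crossExp]
      · simp [hpos j hj, crossExp, hj.ne]

/-- In an ideal contained in `[y₃ - y₄]` and avoiding `σ(y₁)y₂(y₃ - y₄)`, the monomial `σ(y₁)y₂y₃`
occurs in no two-term polynomial. -/
theorem coeff_crossExp_eq_zero {I : Ideal (DPoly ℂ 4)}
    (hfold : I ≤ RingHom.ker (MvPolynomial.rename (R := ℂ) foldVar).toRingHom)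
    (hI : (MvPolynomial.X (0, 1) * MvPolynomial.X (1, 0) *
      (MvPolynomial.X (2, 0) - MvPolynomial.X (3, 0)) : DPoly ℂ 4) ∉ I)
    (f g : Fin 4 × ℕ →₀ ℕ) (a b : ℂ)
    (h : MvPolynomial.monomial f a + MvPolynomial.monomial g b ∈ I) :
    MvPolynomial.coeff (crossExp 2) (MvPolynomial.monomial f a + MvPolynomial.monomial g b) = 0 := by
  have aux : ∀ (g : Fin 4 × ℕ →₀ ℕ) (a b : ℂ), g ≠ crossExp 2 →
      MvPolynomial.monomial (crossExp 2) a + MvPolynomial.monomial g b ∈ I → a = 0 := by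
    intro g a b hg h
    have h0 := congrArg (MvPolynomial.coeff (crossExp 2)) (RingHom.mem_ker.1 (hfold h))
    simp only [AlgHom.toRingHom_eq_coe, RingHom.coe_coe, map_add, MvPolynomial.rename_monomial,
      mapDomain_foldVar_crossExp, MvPolynomial.coeff_add, MvPolynomial.coeff_monomial,
      MvPolynomial.coeff_zero, if_true] at h0
    split_ifs at h0 with hfg
    · obtain rfl := (eq_crossExp_of_mapDomain hfg).resolve_left hg
      obtain rfl : b = -a := by linear_combination h0
      by_contra ha
      apply hI
      convert I.mul_mem_left (MvPolynomial.C a⁻¹) h using 1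
      have hC : (MvPolynomial.C a⁻¹ * MvPolynomial.C a : DPoly ℂ 4) = 1 := by
        rw [← MvPolynomial.C_mul, inv_mul_cancel₀ ha, MvPolynomial.C_1]
      rw [monomial_crossExp, monomial_crossExp, MvPolynomial.C_neg]
      linear_combination -(MvPolynomial.X (0, 1) * MvPolynomial.X (1, 0) *
        (MvPolynomial.X (2, 0) - MvPolynomial.X (3, 0)) : DPoly ℂ 4) * hC
    · simpa using h0
  simp only [MvPolynomial.coeff_add, MvPolynomial.coeff_monomial]
  by_cases hf : f = crossExp 2 <;> by_cases hg : g = crossExp 2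
  · subst hf hg
    have h0 := congrArg (MvPolynomial.coeff (crossExp 2)) (RingHom.mem_ker.1 (hfold h))
    simpa [MvPolynomial.rename_monomial, mapDomain_foldVar_crossExp] using h0
  · subst hf
    simp [hg, aux g a b hg h]
  · subst hg
    simp [hf, aux f b a hf (by rwa [add_comm])]
  · simp [hf, hg]

/-- Over `K = ℂ` with `σ = id` on `ℂ`, in `ℂ{y_1, y_2, y_3, y_4}`, for the
well-mixed closure `I = ⟨y_1²(y_3 − y_4), y_2²(y_3 − y_4)⟩` we have
`(y_1^x y_2 − y_1 y_2^x)(y_3 − y_4) ∈ I` but `y_1^x y_2 (y_3 − y_4) ∉ I` and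
`y_1 y_2^x (y_3 − y_4) ∉ I`; consequently `I` is not a binomial σ-ideal. -/
theorem stmt19 :
    let σ : DPoly ℂ 4 →+* DPoly ℂ 4 := shift (RingHom.id ℂ)
    let y : Fin 4 → DPoly ℂ 4 := fun i => MvPolynomial.X (i, 0)
    let I : Ideal (DPoly ℂ 4) :=
      wmClosure σ {y 0 ^ 2 * (y 2 - y 3), y 1 ^ 2 * (y 2 - y 3)}
    ((σ (y 0) * y 1 - y 0 * σ (y 1)) * (y 2 - y 3) ∈ I) ∧
    (σ (y 0) * y 1 * (y 2 - y 3) ∉ I) ∧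
    (y 0 * σ (y 1) * (y 2 - y 3) ∉ I) ∧
    ¬ ∃ S : Set (DPoly ℂ 4), (∀ p ∈ S, IsBinomial (RingHom.id ℂ) p) ∧
      I = sigmaIdealGen σ S := by
  intro σ y I
  have hσ : ∀ i, σ (y i) = MvPolynomial.X (i, 1) := fun i => by simp [σ, y, shift]
  have hgen := subset_wmClosure σ {y 0 ^ 2 * (y 2 - y 3), y 1 ^ 2 * (y 2 - y 3)}
  have hcross : (σ (y 0) * y 1 - y 0 * σ (y 1)) * (y 2 - y 3) ∈ I :=
    (wmClosure_isWellMixed σ _).cross_mem (hgen (by simp)) (hgen (by simp))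
  have hker : I ≤ RingHom.ker CrossRing.evalHom := by
    refine wmClosure_le_ker CrossRing.evalHom_comp_shift
      (fun _ _ => CrossRing.mul_sigma_eq_zero) ?_
    rintro p (rfl | rfl) <;> apply CrossRing.ext <;>
      simp [y, CrossRing.evalHom, CrossRing.var, pow_two, CrossRing.mul_def, CrossRing.zero_def]
  have hfold : I ≤ RingHom.ker (MvPolynomial.rename (R := ℂ) foldVar).toRingHom := by
    refine wmClosure_le_ker rename_foldVar_comp_shift (fun a b hab => ?_) ?_
    · rcases mul_eq_zero.1 hab with rfl | rfl <;> simp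
    · rintro p (rfl | rfl) <;> simp [y, foldVar]
  have h1 : σ (y 0) * y 1 * (y 2 - y 3) ∉ I := fun h => by
    have : _ = (0 : ℂ) := congrArg CrossRing.asb (RingHom.mem_ker.1 (hker h))
    simp [hσ, y, CrossRing.evalHom, CrossRing.var, CrossRing.mul_def] at this
  have h2 : y 0 * σ (y 1) * (y 2 - y 3) ∉ I := fun h => by
    have : _ = (0 : ℂ) := congrArg CrossRing.asb (RingHom.mem_ker.1 (hker h))
    simp [hσ, y, CrossRing.evalHom, CrossRing.var, CrossRing.mul_def] at this
  refine ⟨hcross, h1, h2, ?_⟩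
  rintro ⟨S, hS, hSI⟩
  rw [hσ] at h1
  have h0 := coeff_eq_zero_of_binomial hS (wmClosure_isSigmaIdeal σ _) hSI
    (coeff_crossExp_eq_zero hfold h1) hcross
  have hexp : (σ (y 0) * y 1 - y 0 * σ (y 1)) * (y 2 - y 3) =
      MvPolynomial.monomial (crossExp 2) 1 - MvPolynomial.monomial (crossExp 3) 1 -
      y 0 * σ (y 1) * (y 2 - y 3) := by
    simp only [monomial_crossExp, hσ, y, MvPolynomial.C_1]
    ring
  have h32 : crossExp 3 ≠ crossExp 2 := fun h => by
    have := DFunLike.congr_fun h (2, 0)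
    simp [crossExp] at this
  have hy : MvPolynomial.coeff (crossExp 2) (y 0 * σ (y 1) * (y 2 - y 3)) = 0 := by
    rw [mul_assoc]
    simp only [y]
    rw [MvPolynomial.coeff_X_mul', if_neg]
    simp [crossExp]
  rw [hexp, MvPolynomial.coeff_sub, MvPolynomial.coeff_sub, hy] at h0
  simp [h32] at h0
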